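/- arXiv:2204.04296 — 2 statements merged into one kernel-verified Lean document; each statement's English description precedes it below -/
import Mathlib

section
/- Let q = 2^n, F = GF(q^4), d = q^3 + q^2 + q - 1, and b ∈ GF(q^2) \ {1}. If b^{q+1} = 1, then the equation x^d + (x+1)^d = b has exactly q^2 - q solutions in F; otherwise it has no solution in F. -/
open Polynomial in
theorem aux_card_fixed (n : ℕ) (hn : 0 < n) (F : Type) [Field F] [Fintype F] [DecidableEq F] [CharP F 2]
    (hF : Fintype.card F = (2^n)^4) (m : ℕ) (hm0 : m ≠ 0) (hm : m ∣ 4) :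
    (Finset.univ.filter (fun x : F => x ^ ((2^n)^m) = x)).card = (2^n)^m := by
  have h1 : 1 < (2:ℕ)^n := Nat.one_lt_two_pow (by omega)
  have h2 : 1 < ((2:ℕ)^n)^m := Nat.one_lt_pow hm0 h1
  have hs : Splits (X ^ ((2^n)^4) - X : F[X]) := by
    have := splits_X_pow_nat_card_sub_X (K := F)
    rwa [Nat.card_eq_fintype_card, hF] at this
  have h0 : (X ^ ((2^n)^4) - X : F[X]) ≠ 0 :=
    FiniteField.X_pow_card_sub_X_ne_zero F (Nat.one_lt_pow (by norm_num) h1)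
  have hs' : Splits (X ^ ((2^n)^m) - X : F[X]) := hs.of_dvd h0 (dvd_pow_pow_sub_self_of_dvd hm)
  have h0' : (X ^ ((2^n)^m) - X : F[X]) ≠ 0 := FiniteField.X_pow_card_sub_X_ne_zero F h2
  have hsep : Separable (X ^ ((2^n)^m) - X : F[X]) := by
    apply galois_poly_separable 2
    rw [← pow_mul]
    exact dvd_pow_self 2 (Nat.mul_ne_zero hn.ne' hm0)
  have hc := hs'.natDegree_eq_card_roots
  rw [FiniteField.X_pow_card_sub_X_natDegree_eq F h2] at hc
  have : (Finset.univ.filter (fun x : F => x ^ ((2^n)^m) = x))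
      = (X ^ ((2^n)^m) - X : F[X]).roots.toFinset := by
    ext x
    simp [h0', sub_eq_zero]
  rw [this, Multiset.toFinset_card_of_nodup (nodup_roots hsep), ← hc]

open Polynomial in
theorem aux_root (n : ℕ) (hn : 0 < n) (F : Type) [Field F] [Fintype F] [CharP F 2]
    (hF : Fintype.card F = (2^n)^4) (c u e : F) (hc : c ≠ 0) (hcf : c ^ ((2^n)^2) = c)
    (huf : u ^ ((2^n)^2) = u) (hef : e ^ ((2^n)^2) = e) :
    ∃ x : F, c * x^2 + u * x + e = 0 := by
  let K := AlgebraicClosure F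
  let i := algebraMap F K
  have : CharP K 2 := charP_of_injective_algebraMap i.injective 2
  have h1 : 1 < (2:ℕ)^n := Nat.one_lt_two_pow (by omega)
  obtain ⟨y, hy⟩ := IsAlgClosed.exists_root (C (i c) * X^2 + C (i u) * X + C (i e))
    (by rw [degree_quadratic (by simpa using hc)]; norm_num)
  simp only [IsRoot, eval_add, eval_mul, eval_C, eval_pow, eval_X] at hy
  let g : K →+* K := iterateFrobenius K 2 (n*2)
  have hg : ∀ z, g z = z ^ ((2^n)^2) := fun z => by
    rw [← pow_mul]; exact iterateFrobenius_def 2 (n*2) z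
  have gc : g (i c) = i c := by rw [hg, ← map_pow, hcf]
  have gu : g (i u) = i u := by rw [hg, ← map_pow, huf]
  have ge : g (i e) = i e := by rw [hg, ← map_pow, hef]
  have hy1 : i c * (g y)^2 + i u * g y + i e = 0 := by
    have := congrArg g hy
    simpa [gc, gu, ge] using this
  have hic : i c ≠ 0 := by simpa using hc
  have h2 : (2:K) = 0 := CharTwo.two_eq_zero
  have hgg : g (g y) = y := by
    by_cases h : g y = y
    · rw [h, h]
    · have e1 : i c * (g y + y) + i u = 0 := by
        have : (g y - y) * (i c * (g y + y) + i u) = 0 := by linear_combination hy1 - hy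
        rcases mul_eq_zero.1 this with h' | h'
        · exact absurd (sub_eq_zero.1 h') h
        · exact h'
      have e2 : i c * (g (g y) + g y) + i u = 0 := by
        have := congrArg g e1
        simpa [gc, gu] using this
      have : i c * (g (g y) - y) = 0 := by linear_combination e2 - e1
      rcases mul_eq_zero.1 this with h' | h'
      · exact absurd h' hic
      · exact sub_eq_zero.1 h'
  rw [hg, hg, ← pow_mul, ← pow_add] at hgg
  have hs : Splits (X ^ ((2^n)^4) - X : F[X]) := by
    have := splits_X_pow_nat_card_sub_X (K := F)
    rwa [Nat.card_eq_fintype_card, hF] at this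
  have h0 : (X ^ ((2^n)^4) - X : F[X]) ≠ 0 :=
    FiniteField.X_pow_card_sub_X_ne_zero F (Nat.one_lt_pow (by norm_num) h1)
  obtain ⟨x, hx⟩ := hs.mem_range_of_isRoot h0 (i := i) (x := y) (by
    simp [IsRoot, hgg])
  refine ⟨x, i.injective ?_⟩
  rw [← hx] at hy
  simpa using hy

theorem aux_two (n : ℕ) (hn : 0 < n) (F : Type) [Field F] [Fintype F] [DecidableEq F] [CharP F 2]
    (hF : Fintype.card F = (2^n)^4) (c u e : F) (hc : c ≠ 0) (hu : u ≠ 0)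
    (hcf : c ^ ((2^n)^2) = c)
    (huf : u ^ ((2^n)^2) = u) (hef : e ^ ((2^n)^2) = e) :
    (Finset.univ.filter (fun x : F => c * x^2 + u * x + e = 0)).card = 2 := by
  obtain ⟨x, hx⟩ := aux_root n hn F hF c u e hc hcf huf hef
  rw [Finset.card_eq_two]
  have h2 : (2:F) = 0 := CharTwo.two_eq_zero
  refine ⟨x, x + u / c, ?_, ?_⟩
  · simp [hu, hc]
  · ext z
    simp only [Finset.mem_filter, Finset.mem_univ, true_and, Finset.mem_insert,
      Finset.mem_singleton]
    constructor
    · intro hz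
      have : (z - x) * (c * (z + x) + u) = 0 := by linear_combination hz - hx
      rcases mul_eq_zero.1 this with h | h
      · exact Or.inl (sub_eq_zero.1 h)
      · right
        field_simp
        linear_combination h - (c * x + u) * h2
    · rintro (rfl | rfl)
      · exact hx
      · have : c * (u / c) = u := by field_simp
        linear_combination hx + (2 * x + u / c) * this + (x * u  + u * (u/c)) * h2

section core
variable {F : Type} [Field F] [CharP F 2] (f : F →+* F)

theorem aux_sp (c T E x : F) (hc2 : f (f c) = c) (hT : f T = T) (hE : f E = E)
    (hx : f (f x) ≠ x) (h : c * (x^2 + x) + T * x + E = 0) :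
    c * (x + f (f x)) = c + T ∧ c * (x * f (f x)) = E := by
  have h2 : (2:F) = 0 := CharTwo.two_eq_zero
  have h' : c * ((f (f x))^2 + f (f x)) + T * f (f x) + E = 0 := by
    have := congrArg (fun t => f (f t)) h
    simpa [hc2, hT, hE] using this
  have e1 : c * (x + f (f x)) + c + T = 0 := by
    have : (f (f x) - x) * (c * (x + f (f x)) + c + T) = 0 := by linear_combination h' - h
    rcases mul_eq_zero.1 this with h | h
    · exact absurd (sub_eq_zero.1 h) hx
    · exact h
  constructor
  · linear_combination e1 - (c + T) * h2
  · linear_combination x * e1 - h + E * h2 - E * h2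

theorem aux_TE (c T E x : F) (hc2 : f (f c) = c)
    (hT : f T = T) (hE : f E = E)
    (hx : f (f x) ≠ x) (h : c * (x^2 + x) + T * x + E = 0) :
    c * f c * (x + f x + f (f x) + f (f (f x))) = T * (c + f c) ∧
    c * f c * ((x * f (f x)) * (f x + f (f (f x))) + (f x * f (f (f x))) * (x + f (f x)))
      = E * (c + f c) := by
  have h2 : (2:F) = 0 := CharTwo.two_eq_zero
  obtain ⟨h1, h3⟩ := aux_sp f c T E x hc2 hT hE hx h
  have h1' : f c * (f x + f (f (f x))) = f c + T := by
    have := congrArg f h1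
    simpa [hT, hE] using this
  have h3' : f c * (f x * f (f (f x))) = E := by
    have := congrArg f h3
    simpa [hT, hE] using this
  constructor
  · linear_combination f c * h1 + c * h1' + (c * f c) * h2
  · linear_combination (f c * (f x + f (f (f x)))) * h3 + E * h1' + c * (x + f (f x)) * h3' + E * h1 + E * T * h2

theorem aux_eq (d : ℕ) (b x : F) (hx0 : x ≠ 0) (hx1 : x ≠ 1)
    (hd : ∀ y, y * y ^ d = f y * f (f y) * f (f (f y))) :
    x ^ d + (x + 1) ^ d = b ↔
    (b + 1) * (x^2 + x) + (x + f x + f (f x) + f (f (f x))) * x +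
    ((x * f (f x)) * (f x + f (f (f x))) + (f x * f (f (f x))) * (x + f (f x))) = 0 := by
  have h2 : (2:F) = 0 := CharTwo.two_eq_zero
  have hx1' : x + 1 ≠ 0 := fun h => hx1 (by linear_combination h - h2)
  have a1 := hd x
  have a2 := hd (x + 1)
  simp only [map_add, map_one] at a2
  constructor
  · intro h
    linear_combination (x * (x+1)) * h - (x+1) * a1 - x * a2 +
      (b * x + b * x^2 - x * f x * f (f x) * f (f (f x)) + x^2) * h2
  · intro h
    have : x * (x + 1) * (x ^ d + (x + 1) ^ d - b) = 0 := by
      linear_combination h + (x+1) * a1 + x * a2 -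
        (b * x + b * x^2 - x * f x * f (f x) * f (f (f x)) + x^2) * h2
    have h3 := (mul_eq_zero.1 this).resolve_left (mul_ne_zero hx0 hx1')
    exact sub_eq_zero.1 h3

theorem aux_sub (d : ℕ) (hd0 : d ≠ 0) (x : F) (hx : f (f x) = x)
    (hd : ∀ y, y * y ^ d = f y * f (f y) * f (f (f y))) : x ^ d = (f x)^2 := by
  by_cases h : x = 0
  · simp [h, hd0]
  · apply mul_left_cancel₀ h
    rw [hd, hx]; ring

theorem aux_sol_not (d : ℕ) (hd0 : d ≠ 0) (b x : F) (hb1 : b ≠ 1)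
    (hd : ∀ y, y * y ^ d = f y * f (f y) * f (f (f y)))
    (h : x ^ d + (x + 1) ^ d = b) : f (f x) ≠ x := by
  intro hx
  have h2 : (2:F) = 0 := CharTwo.two_eq_zero
  rw [aux_sub f d hd0 x hx hd, aux_sub f d hd0 (x+1) (by simp [hx]) hd, map_add, map_one] at h
  exact hb1 (by linear_combination -h + ((f x)^2 + f x) * h2)

theorem aux_nosol (d : ℕ) (hd0 : d ≠ 0) (b x : F) (hb1 : b ≠ 1) (hb : f (f b) = b)
    (hf4 : ∀ x, f (f (f (f x))) = x)
    (hd : ∀ y, y * y ^ d = f y * f (f y) * f (f (f y)))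
    (hbb : f b * b ≠ 1) : x ^ d + (x + 1) ^ d ≠ b := by
  intro h
  have h2 : (2:F) = 0 := CharTwo.two_eq_zero
  have hx := aux_sol_not f d hd0 b x hb1 hd h
  have hx0 : x ≠ 0 := by rintro rfl; simp at hx
  have hx1 : x ≠ 1 := by rintro rfl; simp at hx
  have h' := (aux_eq f d b x hx0 hx1 hd).1 h
  obtain ⟨u, v⟩ := aux_TE f (b+1) _ _ x (by simp [hb]) (by simp only [map_add, hf4]; ring)
    (by simp only [map_add, map_mul, hf4]; ring) hx h'
  set T := x + f x + f (f x) + f (f (f x))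
  set E := (x * f (f x)) * (f x + f (f (f x))) + (f x * f (f (f x))) * (x + f (f x))
  simp only [map_add, map_one] at u v
  have hne : f b * b - 1 ≠ 0 := sub_ne_zero.2 hbb
  have hT : T = 0 := by
    have : (f b * b - 1) * T = 0 := by linear_combination u
    exact (mul_eq_zero.1 this).resolve_left hne
  have hE : E = 0 := by
    have : (f b * b - 1) * E = 0 := by linear_combination v
    exact (mul_eq_zero.1 this).resolve_left hne
  rw [hT, hE] at h'
  have h3 : (b - 1) * (x * (x - 1)) = 0 := by
    linear_combination h' - (x^2 + x * b) * h2
  rcases mul_eq_zero.1 h3 with h4 | h4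
  · exact hb1 (sub_eq_zero.1 h4)
  · rcases mul_eq_zero.1 h4 with h4 | h4
    · exact hx0 h4
    · exact hx1 (sub_eq_zero.1 h4)

theorem aux_count [Fintype F] [DecidableEq F] (d : ℕ) (hd0 : d ≠ 0) (b : F) (hb1 : b ≠ 1)
    (hb : f (f b) = b)
    (hf4 : ∀ x, f (f (f (f x))) = x)
    (hd : ∀ y, y * y ^ d = f y * f (f y) * f (f (f y)))
    (hbb : f b * b = 1) (q : ℕ)
    (hK0 : (Finset.univ.filter (fun x : F => f x = x)).card = q)
    (hK2 : (Finset.univ.filter (fun x : F => f (f x) = x)).card = q ^ 2)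
    (htwo : ∀ c u e : F, c ≠ 0 → u ≠ 0 → f (f c) = c → f (f u) = u → f (f e) = e →
      (Finset.univ.filter (fun x : F => c * x^2 + u * x + e = 0)).card = 2) :
    (Finset.univ.filter (fun x : F => x ^ d + (x + 1) ^ d = b)).card = q ^ 2 - q := by
  have h2 : (2:F) = 0 := CharTwo.two_eq_zero
  obtain ⟨c, hc⟩ : ∃ c, c = b + 1 := ⟨_, rfl⟩
  have hc2 : f (f c) = c := by simp [hc, hb]
  have hc0 : c ≠ 0 := by
    rintro rfl
    exact hb1 (by linear_combination -hc - h2)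
  have hfc0 : f c ≠ 0 := by simpa using hc0
  have hcc : c + f c = c * f c := by
    rw [hc, map_add, map_one]
    linear_combination -hbb + (1 - 1) * h2
  have hcK : f c ≠ c := by
    intro h
    rw [h] at hcc
    have : c * c = 0 := by linear_combination -hcc + c * h2
    simp [hc0] at this
  set K0 := Finset.univ.filter (fun x : F => f x = x) with hK0d
  set K2 := Finset.univ.filter (fun x : F => f (f x) = x) with hK2d
  set S := Finset.univ.filter (fun x : F => x ^ d + (x + 1) ^ d = b) with hSd
  have hsub : K0 ⊆ K2 := by
    intro x hx
    simp only [hK0d, hK2d, Finset.mem_filter, Finset.mem_univ, true_and] at hx ⊢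
    rw [hx, hx]
  let R : F × F → F → Prop := fun p x => c * (x^2 + x) + p.1 * x + p.2 = 0
  have hdc := Finset.sum_card_bipartiteAbove_eq_sum_card_bipartiteBelow
    (s := K0 ×ˢ K0) (t := (Finset.univ : Finset F)) R
  have hL : ∑ p ∈ K0 ×ˢ K0, ((Finset.univ : Finset F).bipartiteAbove R p).card = q * q * 2 := by
    rw [Finset.sum_const_nat (m := 2), Finset.card_product, hK0]
    rintro ⟨T, E⟩ hp
    simp only [hK0d, Finset.mem_product, Finset.mem_filter, Finset.mem_univ, true_and] at hp
    refine Eq.trans ?_ (htwo c (c + T) E hc0 ?_ hc2 (by simp [hc2, hp.1]) (by simp [hp.2]))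
    · congr 1
      ext x
      simp only [Finset.bipartiteAbove, Finset.mem_filter, R]
      ring_nf
    · intro h
      have : T = c := by linear_combination h - c * h2
      exact hcK (this ▸ hp.1)
  have hxx : ∀ x, x ∉ K0 → ∀ p ∈ K0 ×ˢ K0, ∀ p' ∈ K0 ×ˢ K0, R p x → R p' x → p = p' := by
    rintro x hx ⟨T, E⟩ hp ⟨T', E'⟩ hp' h h'
    simp only [hK0d, Finset.mem_product, Finset.mem_filter, Finset.mem_univ, true_and, R]
      at hx hp hp' h h'
    have e1 : (T - T') * x + (E - E') = 0 := by linear_combination h - h'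
    have e2 : (T - T') * f x + (E - E') = 0 := by
      have := congrArg f e1
      simpa [hp.1, hp.2, hp'.1, hp'.2] using this
    have e3 : (T - T') * (f x - x) = 0 := by linear_combination e2 - e1
    have hT : T - T' = 0 := (mul_eq_zero.1 e3).resolve_right (sub_ne_zero.2 hx)
    have hE : E - E' = 0 := by linear_combination e1 - x * hT
    rw [sub_eq_zero.1 hT, sub_eq_zero.1 hE]
  have hone : ∀ x, x ∉ K0 → (∃ p ∈ K0 ×ˢ K0, R p x) →
      ((K0 ×ˢ K0).bipartiteBelow R x).card = 1 := by
    rintro x hx ⟨p, hp, hR⟩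
    rw [Finset.card_eq_one]
    refine ⟨p, ?_⟩
    ext p'
    simp only [Finset.bipartiteBelow, Finset.mem_filter, Finset.mem_singleton]
    constructor
    · rintro ⟨h1, h3⟩
      exact hxx x hx p' h1 p hp h3 hR
    · rintro rfl
      exact ⟨hp, hR⟩
  have hzero : ∀ x, (¬ ∃ p ∈ K0 ×ˢ K0, R p x) →
      ((K0 ×ˢ K0).bipartiteBelow R x).card = 0 := by
    intro x h
    rw [Finset.card_eq_zero, Finset.bipartiteBelow, Finset.filter_eq_empty_iff]
    intro p hp hR
    exact h ⟨p, hp, hR⟩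
  have hpt : ∀ x : F, ((K0 ×ˢ K0).bipartiteBelow R x).card =
      (if x ∈ S then 1 else 0) + (if x ∈ K2 \ K0 then 1 else 0) +
        (if x ∈ ({0, 1} : Finset F) then q else 0) := by
    intro x
    by_cases hx2 : x ∈ K2
    · have hxf : f (f x) = x := by simpa [hK2d] using hx2
      have hxS : x ∉ S := by
        intro h
        exact aux_sol_not f d hd0 b x hb1 hd (by simpa [hSd] using h) hxf
      by_cases hx0 : x ∈ K0
      · have hxg : f x = x := by simpa [hK0d] using hx0
        by_cases h01 : x ∈ ({0, 1} : Finset F)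
        · simp only [hxS, hx0, h01, if_true, if_false, Finset.mem_sdiff, not_true, and_false,
            zero_add]
          rw [← hK0]
          symm
          simp only [Finset.mem_insert, Finset.mem_singleton] at h01
          rcases h01 with rfl | rfl
          · refine Finset.card_bij (fun T _ => (T, 0)) ?_ ?_ ?_
            · intro T hT
              simp [Finset.bipartiteBelow, R, hT, hK0d] at *
              exact hT
            · intro a _ b _ h
              exact (Prod.mk.inj h).1
            · rintro ⟨T, E⟩ h
              simp [Finset.bipartiteBelow, R] at h
              exact ⟨T, h.1.1, by simp [h.2]⟩
          · refine Finset.card_bij (fun T _ => (T, T)) ?_ ?_ ?_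
            · intro T hT
              simp only [Finset.bipartiteBelow, R, Finset.mem_filter, Finset.mem_product]
              exact ⟨⟨hT, hT⟩, by linear_combination (c + T) * h2⟩
            · intro a _ b _ h
              exact (Prod.mk.inj h).1
            · rintro ⟨T, E⟩ h
              simp only [Finset.bipartiteBelow, R, Finset.mem_filter, Finset.mem_product] at h
              refine ⟨T, h.1.1, ?_⟩
              have : T = E := by linear_combination h.2 - (c + E) * h2
              rw [this]
        · rw [hzero]
          · simp [hxS, hx0, h01]
          · rintro ⟨⟨T, E⟩, hp, h⟩
            simp only [hK0d, Finset.mem_product, Finset.mem_filter, Finset.mem_univ, true_and, R]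
              at hp h
            have h' : f c * (x^2 + x) + T * x + E = 0 := by
              have := congrArg f h
              simpa [hp.1, hp.2, hxg] using this
            have : (f c - c) * (x * (x - 1)) = 0 := by
              linear_combination h' - h - (f c - c) * x * h2
            simp only [Finset.mem_insert, Finset.mem_singleton, not_or] at h01
            rcases mul_eq_zero.1 this with h4 | h4
            · exact hcK (sub_eq_zero.1 h4)
            · rcases mul_eq_zero.1 h4 with h4 | h4
              · exact h01.1 h4
              · exact h01.2 (sub_eq_zero.1 h4)
      · have hxg : f x ≠ x := by simpa [hK0d] using hx0
        have h01 : x ∉ ({0, 1} : Finset F) := by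
          simp only [Finset.mem_insert, Finset.mem_singleton, not_or]
          exact ⟨by rintro rfl; simp at hxg, by rintro rfl; simp at hxg⟩
        rw [hone x hx0]
        · simp [hxS, hx0, h01, hx2]
        · have hne : f x - x ≠ 0 := sub_ne_zero.2 hxg
          have hne' : x - f x ≠ 0 := sub_ne_zero.2 hxg.symm
          let T := -(f c * ((f x)^2 + f x) - c * (x^2 + x)) / (f x - x)
          have hT1 : T * (f x - x) = -(f c * ((f x)^2 + f x) - c * (x^2 + x)) :=
            div_mul_cancel₀ _ hne
          have hT : f T = T := by
            have h3 := congrArg f hT1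
            simp only [map_mul, map_sub, map_neg, map_add, map_pow, hxf, hc2] at h3
            have h4 : (f T - T) * (x - f x) = 0 := by
              linear_combination h3 + hT1
            exact sub_eq_zero.1 ((mul_eq_zero.1 h4).resolve_right hne')
          refine ⟨(T, -(c * (x^2 + x) + T * x)), ?_, ?_⟩
          · simp only [hK0d, Finset.mem_product, Finset.mem_filter, Finset.mem_univ, true_and]
            refine ⟨hT, ?_⟩
            simp only [map_mul, map_neg, map_add, map_pow, hT]
            linear_combination -hT1
          · simp only [R]; ring
    · have hxf : f (f x) ≠ x := by simpa [hK2d] using hx2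
      have hx0 : x ∉ K0 := fun h => hx2 (hsub h)
      have hx00 : x ≠ 0 := by rintro rfl; simp at hxf
      have hx01 : x ≠ 1 := by rintro rfl; simp at hxf
      have h01 : x ∉ ({0, 1} : Finset F) := by simp [hx00, hx01]
      have heq := aux_eq f d b x hx00 hx01 hd
      rw [← hc] at heq
      by_cases hS : x ∈ S
      · rw [hone x hx0]
        · simp [hS, h01, hx2]
        · refine ⟨(x + f x + f (f x) + f (f (f x)),
            (x * f (f x)) * (f x + f (f (f x))) + (f x * f (f (f x))) * (x + f (f x))), ?_,
            heq.1 (by simpa [hSd] using hS)⟩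
          simp only [hK0d, Finset.mem_product, Finset.mem_filter, Finset.mem_univ, true_and]
          constructor
          · simp only [map_add, hf4]; ring
          · simp only [map_add, map_mul, hf4]; ring
      · rw [hzero]
        · simp [hS, h01, hx2]
        · rintro ⟨⟨T, E⟩, hp, h⟩
          simp only [hK0d, Finset.mem_product, Finset.mem_filter, Finset.mem_univ, true_and, R]
            at hp h
          obtain ⟨u, v⟩ := aux_TE f c T E x hc2 hp.1 hp.2 hxf h
          rw [hcc, mul_comm _ (c * f c)] at u v
          have u' := mul_left_cancel₀ (mul_ne_zero hc0 hfc0) u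
          have v' := mul_left_cancel₀ (mul_ne_zero hc0 hfc0) v
          rw [u', v'] at heq
          exact hS (by simpa [hSd] using heq.2 h)
  have hcard2 : (K2 \ K0).card = q ^ 2 - q := by
    rw [Finset.card_sdiff_of_subset hsub, hK0, hK2]
  have hle : q ≤ q ^ 2 := by
    have := Finset.card_le_card hsub
    rwa [hK0, hK2] at this
  have hRR : ∑ x : F, ((K0 ×ˢ K0).bipartiteBelow R x).card = S.card + (q^2 - q) + 2 * q := by
    simp_rw [hpt]
    rw [Finset.sum_add_distrib, Finset.sum_add_distrib, ← hcard2]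
    congr 1
    · congr 1
      · simp
      · rw [Finset.sum_ite_mem, Finset.univ_inter, Finset.card_eq_sum_ones]
    · rw [Finset.sum_ite_mem, Finset.univ_inter, Finset.sum_pair zero_ne_one]; ring
  have : q * q = q ^ 2 := by ring
  rw [hL, hRR, this] at hdc
  omega
end core


theorem solutions_b_in_subfield (n : ℕ) (hn : 0 < n) (F : Type) [Field F] [Fintype F]
    (hF : Fintype.card F = (2^n)^4) (b : F) (hb : b ^ ((2^n)^2) = b) (hb1 : b ≠ 1) :
    (b ^ (2^n + 1) = 1 →
      {x : F | x ^ ((2^n)^3 + (2^n)^2 + 2^n - 1) + (x + 1) ^ ((2^n)^3 + (2^n)^2 + 2^n - 1) = b}.ncard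
        = (2^n)^2 - 2^n) ∧
    (b ^ (2^n + 1) ≠ 1 →
      {x : F | x ^ ((2^n)^3 + (2^n)^2 + 2^n - 1) + (x + 1) ^ ((2^n)^3 + (2^n)^2 + 2^n - 1) = b}.ncard
        = 0) := by

  classical
  have hF' : Fintype.card F = 2 ^ (n * 4) := by rw [hF, pow_mul]
  have : CharP F 2 := charP_of_card_eq_prime_pow hF'
  have h1 : 1 < (2:ℕ)^n := Nat.one_lt_two_pow (by omega)
  let f : F →+* F := iterateFrobenius F 2 n
  have hf : ∀ x, f x = x ^ (2^n) := fun x => iterateFrobenius_def 2 n x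
  have hff : ∀ x, f (f x) = x ^ ((2^n)^2) := fun x => by rw [hf, hf, ← pow_mul, sq]
  have hf4 : ∀ x, f (f (f (f x))) = x := fun x => by
    rw [hff, hff, ← pow_mul, ← pow_add]
    have := FiniteField.pow_card x
    rwa [hF] at this
  set d := (2^n)^3 + (2^n)^2 + 2^n - 1 with hdd
  have hd1 : d + 1 = (2^n)^3 + (2^n)^2 + 2^n := by omega
  have hd0 : d ≠ 0 := by omega
  have hd : ∀ y, y * y ^ d = f y * f (f y) * f (f (f y)) := fun y => by
    rw [← pow_succ', hd1, hff, hf, hf, ← pow_mul y, ← pow_add, ← pow_add]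
    congr 1; ring
  have hbf : f (f b) = b := by rw [hff, hb]
  have hbp : b ^ (2^n + 1) = f b * b := by rw [hf, pow_succ]
  rw [hbp]
  constructor
  · intro hbb
    rw [Set.ncard_eq_toFinset_card', Set.toFinset_ofPred]
    refine aux_count f d hd0 b hb1 hbf hf4 hd hbb (2^n) ?_ ?_ ?_
    · have := aux_card_fixed n hn F hF 1 (by norm_num) (by norm_num)
      simpa only [hf, pow_one] using this
    · simp only [hff]
      exact aux_card_fixed n hn F hF 2 (by norm_num) (by norm_num)
    · intro c u e hc hu hcf huf hef
      rw [hff] at hcf huf hef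
      exact aux_two n hn F hF c u e hc hu hcf huf hef
  · intro hbb
    rw [Set.ncard_eq_zero]
    ext x
    simpa using aux_nosol f d hd0 b x hb1 hbf hf4 hd hbb
end

section
/- Let q = 2^n, F = GF(q^4), d = q^3 + q^2 + q - 1. The function x ↦ x^d + (x+1)^d on F has differential-type value distribution: the power map x ↦ x^d over F = GF(2^{4n}) satisfies that for all a ∈ F* and b ∈ F, the equation (ax)^d... simplifies so that max over b of the number of solutions to x^d + (x+1)^d = b equals q^2. -/
namespace MSC
variable {F : Type} [Field F]

theorem quad (τ : F →+* F) (u v w y : F) (hu : u ≠ 0) (h : u * y ^ 2 + v * y + w = 0)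
    (hτu : τ u = u) (hτv : τ v = v) (hτw : τ w = w) : τ (τ y) = y := by
  have h1 : u * (τ y) ^ 2 + v * τ y + w = 0 := by
    have := congrArg τ h
    simpa [hτu, hτv, hτw] using this
  have h3 : (y - τ y) * (u * (y + τ y) + v) = 0 := by linear_combination h - h1
  rcases mul_eq_zero.mp h3 with h4 | h4
  · have : τ y = y := (sub_eq_zero.mp h4).symm
    rw [this, this]
  · have h5 : u * (τ y + τ (τ y)) + v = 0 := by
      have := congrArg τ h4
      simpa [hτu, hτv] using this
    have : u * (τ (τ y) - y) = 0 := by linear_combination h5 - h4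
    rcases mul_eq_zero.mp this with h6 | h6
    · exact absurd h6 hu
    · exact sub_eq_zero.mp h6

theorem two_roots (h2 : (2 : F) = 0) (b m a x y : F) (hx : b * x ^ 2 + m * x = a)
    (hy : b * y ^ 2 + m * y = a) (hne : x ≠ y) : b * (x + y) = m ∧ b * x * y = a := by
  have h3 : (x - y) * (b * (x + y) + m) = 0 := by linear_combination hx - hy
  have h4 : b * (x + y) + m = 0 := (mul_eq_zero.mp h3).resolve_left (sub_ne_zero.mpr hne)
  constructor
  · linear_combination h4 - m * h2
  · linear_combination x * h4 - hx - a * h2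

theorem alg (h2 : (2 : F) = 0) (x x1 x2 x3 α s β : F) (hs : s ≠ 0) (hα : α ≠ 0) (hγ : α + s ≠ 0)
    (hP : x * (x + 1) ≠ 0)
    (h0 : x * x1 * x2 * x3 = α ^ 2)
    (h1 : (x + 1) * (x1 + 1) * (x2 + 1) * (x3 + 1) = (α + s) ^ 2)
    (hk : (s * x + α) * (s * x1 + α) * (s * x2 + α) * (s * x3 + α) = α ^ 2 * (α + s) ^ 2)
    (hβ : β * (x * (x + 1)) = s * x + α) :
    s * β ^ 2 + (x + x1 + x2 + x3) * β + s = 0 := by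
  obtain ⟨e1, he1⟩ : ∃ e, e = x + x1 + x2 + x3 := ⟨_, rfl⟩
  obtain ⟨e2, he2⟩ : ∃ e, e = x*x1 + x*x2 + x*x3+x1*x2+x1*x3+x2*x3 := ⟨_, rfl⟩
  obtain ⟨e3, he3⟩ : ∃ e, e = x*x1*x2 + x*x1*x3 + x*x2*x3+x1*x2*x3 := ⟨_, rfl⟩
  have hchi : x^4 - e1*x^3+e2*x^2-e3*x+α^2 = 0 := by rw [← h0, he1, he2, he3]; ring
  have g1 : 1 + e1 + e2 + e3 + α^2 = (α+s)^2 := by rw [← h1, ← h0, he1, he2, he3]; ring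
  have gk : s^4*α^2 + s^3*α*e3+s^2*α^2*e2+s*α^3*e1+α^4 = α^2*(α+s)^2 := by
    rw [he1, he2, he3]; linear_combination hk - s^4*h0
  rw [← he1]
  clear he1 he2 he3 h0 h1 hk
  obtain ⟨u, hu⟩ : ∃ u, u = s*e2+s+s^3+e1*(s+α) := ⟨_, rfl⟩
  obtain ⟨v, hv⟩ : ∃ v, v = s*e3+e1*α := ⟨_, rfl⟩
  have k1 : u + v = 0 := by
    rw [hu, hv]; linear_combination s * g1 + (e1*α+s^3+s^2*α)*h2
  have k2 : s * α * (α * u + s * v) = 0 := by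
    rw [hu, hv]; linear_combination gk + (α^2*s^2+α^3*s+s^2*α^2*e1)*h2
  have k3 : α * u + s * v = 0 := (mul_eq_zero.mp k2).resolve_left (mul_ne_zero hs hα)
  have k4 : (α + s) * u = 0 := by
    linear_combination k3 - s * k1 + s*u*h2
  have k5 : u = 0 := (mul_eq_zero.mp k4).resolve_left hγ
  have k6 : v = 0 := by
    linear_combination k1 - k5
  have k7 : (x * (x+1))^2 * (s * β ^ 2 + e1 * β + s) = 0 := by
    have : (x * (x+1))^2 * (s * β ^ 2 + e1 * β + s) = s * (s*x+α)^2 + e1 * (s*x+α)*(x * (x+1)) + s * (x * (x+1))^2 := by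
      rw [← hβ]; ring
    rw [this]
    linear_combination s*hchi + x^2*(k5 - hu) + x*(k6-hv) + (s*x^3+s*e1*x^3-s*e2*x^2+s^2*α*x)*h2
  exact (mul_eq_zero.mp k7).resolve_left (pow_ne_zero 2 hP)

theorem fiber2 (h2 : (2 : F) = 0) (β m a : F) (hβ : β ≠ 0) (T : Finset F)
    (h : ∀ x ∈ T, β * x ^ 2 + m * x = a) : T.card ≤ 2 := by
  classical
  rcases T.eq_empty_or_nonempty with rfl | ⟨x0, hx0⟩
  · simp
  · have : T ⊆ {x0, m / β - x0} := by
      intro x hx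
      by_cases hne : x = x0
      · simp [hne]
      · have := (two_roots h2 β m a x x0 (h x hx) (h x0 hx0) hne).1
        have : x = m / β - x0 := by
          rw [← this]; field_simp; ring
        simp [this]
    exact (Finset.card_le_card this).trans Finset.card_le_two

/-- the norm -/
def nm (σ : F →+* F) (x : F) : F := x * σ x * σ (σ x) * σ (σ (σ x))

theorem nm_mul (σ : F →+* F) (x y : F) : nm σ (x * y) = nm σ x * nm σ y := by
  simp only [nm, map_mul]; ring

theorem nm_fix (σ : F →+* F) (hσ : ∀ x, σ (σ (σ (σ x))) = x) (x : F) :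
    σ (nm σ x) = nm σ x := by
  simp only [nm, map_mul, hσ]; ring

theorem sq_inj (h2 : (2 : F) = 0) {x y : F} (h : x ^ 2 = y ^ 2) : x = y := by
  have : (x - y) ^ 2 = 0 := by linear_combination h + (y^2 - x*y) * h2
  exact sub_eq_zero.mp (pow_eq_zero_iff (two_ne_zero) |>.mp this)

theorem core [Fintype F] [DecidableEq F] (h2 : (2 : F) = 0) (σ : F →+* F)
    (hσ : ∀ x, σ (σ (σ (σ x))) = x) (q : ℕ) (hq : 2 ≤ q)
    (hcard : (Finset.univ.filter (fun x : F => σ x = x)).card ≤ q)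
    (al ga : F → F) (hal : ∀ x, al x ^ 2 = nm σ x) (hga : ∀ x, ga x ^ 2 = nm σ (x + 1))
    (β : F) (S : Finset F) (hS : ∀ x ∈ S, σ (σ x) ≠ x)
    (hE : ∀ x ∈ S, β * x ^ 2 + (β + (al x + ga x)) * x = al x) : S.card ≤ q ^ 2 := by
  set Q := Finset.univ.filter (fun x : F => σ x = x) with hQ
  have memQ : ∀ x, x ∈ Q ↔ σ x = x := by intro x; simp [hQ]
  have alQ : ∀ x, σ (al x) = al x := fun x => sq_inj h2 (by rw [← map_pow, hal, nm_fix σ hσ])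
  have gaQ : ∀ x, σ (ga x) = ga x := fun x => sq_inj h2 (by rw [← map_pow, hga, nm_fix σ hσ])
  have hx0 : ∀ x ∈ S, x ≠ 0 := fun x hx h => hS x hx (by simp [h])
  have hx1 : ∀ x ∈ S, x + 1 ≠ 0 := fun x hx h => hS x hx (by
    rw [eq_neg_of_add_eq_zero_left h]; simp)
  have nm0 : ∀ x, x ≠ 0 → nm σ x ≠ 0 := by
    intro x hx
    simp [nm, hx]
  have al0 : ∀ x ∈ S, al x ≠ 0 := fun x hx h => nm0 x (hx0 x hx) (by rw [← hal, h]; simp)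
  have ga0 : ∀ x ∈ S, ga x ≠ 0 := fun x hx h => nm0 _ (hx1 x hx) (by rw [← hga, h]; simp)
  have key : ∀ x ∈ S, β * (x * (x + 1)) = (al x + ga x) * x + al x := fun x hx => by
    linear_combination hE x hx - (al x + ga x) * x * h2
  by_cases hβ0 : β = 0
  · have : S = ∅ := by
      rw [Finset.eq_empty_iff_forall_notMem]
      intro x hx
      have h := hE x hx
      have hs : al x + ga x ≠ 0 := by
        intro h0
        apply al0 x hx
        rw [← h, h0, hβ0]; ring
      apply hS x hx
      have : x = al x / (al x + ga x) := by
        rw [eq_div_iff hs]; rw [hβ0] at h; linear_combination h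
      have h3 : σ x = x := by
        conv_lhs => rw [this]
        rw [map_div₀, map_add, alQ, gaQ, ← this]
      rw [h3, h3]
    simp [this]
  by_cases hK : σ (σ β) = β
  · -- β in the quadratic subfield
    have hmaps : ∀ x ∈ S, al x + ga x ∈ Q := fun x _ => by rw [memQ, map_add, alQ, gaQ]
    have := Finset.card_le_mul_card_image_of_maps_to hmaps q (by
      intro s hs
      rw [memQ] at hs
      set X := S.filter (fun x => al x + ga x = s) with hX
      rcases X.eq_empty_or_nonempty with h | ⟨x0, hx0X⟩
      · simp [h]
      set Y := Finset.univ.filter (fun x : F => β * x ^ 2 + (β + s) * x ∈ Q) with hY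
      have hYc : Y.card ≤ 2 * Q.card := by
        apply Finset.card_le_mul_card_image_of_maps_to
          (f := fun x : F => β * x ^ 2 + (β + s) * x) (fun x hx => by simpa [hY] using hx)
        intro a _
        apply fiber2 h2 β (β + s) a hβ0
        intro x hx
        exact (Finset.mem_filter.mp hx).2
      have hXm : ∀ x ∈ X, σ (σ x) ≠ x ∧ β * x ^ 2 + (β + s) * x ∈ Q ∧
          β * (x + σ (σ x)) = β + s := by
        intro x hx
        obtain ⟨hxS, hxs⟩ := Finset.mem_filter.mp hx
        have e := hE x hxS
        rw [hxs] at e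
        refine ⟨hS x hxS, by rw [e, memQ, alQ], ?_⟩
        have e2 : β * (σ (σ x)) ^ 2 + (β + s) * σ (σ x) = al x := by
          have := congrArg (fun z => σ (σ z)) e
          simpa [hK, hs, alQ] using this
        exact (two_roots h2 β (β + s) (al x) x _ e e2 (hS x hxS).symm).1
      have hdisj : Disjoint X (X.image (fun x => x + x0)) := by
        rw [Finset.disjoint_left]
        intro y hy hy'
        obtain ⟨x, hx, rfl⟩ := Finset.mem_image.mp hy'
        apply (hXm _ hy).1
        have a1 := (hXm _ hx).2.2
        have a2 := (hXm _ hx0X).2.2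
        have a3 : x + σ (σ x) = x0 + σ (σ x0) := mul_left_cancel₀ hβ0 (a1.trans a2.symm)
        simp only [map_add]
        linear_combination a3 + (σ (σ x0) - x) * h2
      have hsub : X ∪ X.image (fun x => x + x0) ⊆ Y := by
        intro y hy
        rcases Finset.mem_union.mp hy with hy | hy
        · simpa [hY] using (hXm y hy).2.1
        · obtain ⟨x, hx, rfl⟩ := Finset.mem_image.mp hy
          have a1 := (hXm _ hx).2.1
          have a2 := (hXm _ hx0X).2.1
          rw [hY, Finset.mem_filter]
          refine ⟨Finset.mem_univ _, ?_⟩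
          rw [memQ] at a1 a2 ⊢
          have e : β * (x + x0) ^ 2 + (β + s) * (x + x0) =
            (β * x ^ 2 + (β + s) * x) + (β * x0 ^ 2 + (β + s) * x0) := by
            linear_combination β * x * x0 * h2
          rw [e, map_add, a1, a2]
      have := Finset.card_le_card hsub
      rw [Finset.card_union_of_disjoint hdisj,
        Finset.card_image_of_injective _ (add_left_injective x0)] at this
      omega)
    nlinarith
  · by_cases hN : nm σ β = 1
    · have hs0 : ∀ x ∈ S, al x + ga x = 0 := by
        intro x hx
        by_contra hs
        apply hK
        have hm : nm σ ((al x + ga x) * x + al x) = al x ^ 2 * ga x ^ 2 := by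
          rw [← key x hx, nm_mul, nm_mul, hN, hal, hga, one_mul]
        have hg : al x + (al x + ga x) = ga x := by linear_combination al x * h2
        have h := alg h2 x (σ x) (σ (σ x)) (σ (σ (σ x))) (al x) (al x + ga x) β hs (al0 x hx)
          (by rw [hg]; exact ga0 x hx) (mul_ne_zero (hx0 x hx) (hx1 x hx))
          (by rw [hal]; rfl) (by rw [hg, hga]; simp [nm])
          (by rw [hg, ← hm]; simp [nm, alQ, gaQ]) (key x hx)
        refine quad σ _ _ _ β hs h ?_ ?_ ?_
        · rw [map_add, alQ, gaQ]
        · simp only [map_add, hσ]; ring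
        · rw [map_add, alQ, gaQ]
      have := Finset.card_le_mul_card_image_of_maps_to (f := al) (s := S) (t := Q)
        (fun x _ => by rw [memQ, alQ]) 2 (by
          intro a _
          apply fiber2 h2 β β a hβ0
          intro x hx
          obtain ⟨hxS, rfl⟩ := Finset.mem_filter.mp hx
          have := hE x hxS
          rwa [hs0 x hxS, add_zero] at this)
      nlinarith
    · have : S.card ≤ (Q ×ˢ Q).card := by
        apply Finset.card_le_card_of_injOn (fun x => (al x, ga x))
        · intro x _
          simp [memQ, alQ, gaQ]
        · intro x hx y hy hxy
          by_contra hne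
          obtain ⟨h1, h3⟩ := Prod.mk.inj hxy
          have ey := hE y hy
          rw [← h1, ← h3] at ey
          have e := (two_roots h2 β _ _ x y (hE x hx) ey hne).2
          have e2 := congrArg (nm σ) e
          rw [nm_mul, nm_mul, ← hal x, ← hal y, ← h1] at e2
          have e3 : nm σ (al x) = al x ^ 4 := by simp only [nm, alQ]; ring
          rw [e3] at e2
          apply hN
          have h4 := pow_ne_zero 4 (al0 x hx)
          apply mul_right_cancel₀ h4
          linear_combination e2
      rw [Finset.card_product] at this
      nlinarith

theorem card_fix_le [Fintype F] [DecidableEq F] (m : ℕ) (hm : 1 < m) :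
    (Finset.univ.filter (fun x : F => x ^ m = x)).card ≤ m := by
  have hne := FiniteField.X_pow_card_sub_X_ne_zero F hm
  have hd := FiniteField.X_pow_card_sub_X_natDegree_eq F hm
  have hsub : (Finset.univ.filter (fun x : F => x ^ m = x)) ⊆
      (Polynomial.X ^ m - Polynomial.X : Polynomial F).roots.toFinset := by
    intro x hx
    have := (Finset.mem_filter.mp hx).2
    simp [hne, this]
  calc _ ≤ _ := Finset.card_le_card hsub
    _ ≤ _ := Multiset.toFinset_card_le _
    _ ≤ _ := Polynomial.card_roots' _
    _ = m := hd

theorem card_K [Fintype F] [DecidableEq F] (h2 : (2 : F) = 0) (σ : F →+* F)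
    (hσ : ∀ x, σ (σ (σ (σ x))) = x) (q : ℕ) (hF : Fintype.card F = q ^ 4) :
    q ^ 2 ≤ (Finset.univ.filter (fun x : F => σ (σ x) = x)).card := by
  set K := Finset.univ.filter (fun x : F => σ (σ x) = x) with hK
  have memK : ∀ x, x ∈ K ↔ σ (σ x) = x := by intro x; simp [hK]
  have := Finset.card_le_mul_card_image_of_maps_to (f := fun x : F => σ (σ x) + x)
    (s := Finset.univ) (t := K) (fun x _ => by rw [memK]; simp [hσ, add_comm]) K.card (by
      intro a _
      set T := Finset.univ.filter (fun x : F => σ (σ x) + x = a) with hT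
      rcases T.eq_empty_or_nonempty with h | ⟨x0, hx0⟩
      · simp [h]
      · apply Finset.card_le_card_of_injOn (fun x => x - x0)
        · intro x hx
          have hx : σ (σ x) + x = a := by simpa [hT] using hx
          have hx0 : σ (σ x0) + x0 = a := by simpa [hT] using hx0
          simp only [Finset.mem_coe, memK, map_sub]
          linear_combination hx - hx0 + (x0 - x) * h2
        · intro x _ y _ h
          exact sub_left_injective h)
  rw [Finset.card_univ, hF] at this
  by_contra h
  nlinarith

end MSC

open MSC in
theorem max_solution_count (n : ℕ) (hn : 0 < n) (F : Type) [Field F] [Fintype F]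
    (hF : Fintype.card F = (2^n)^4) :
    (∀ b : F,
      {x : F | x ^ ((2^n)^3 + (2^n)^2 + 2^n - 1) + (x + 1) ^ ((2^n)^3 + (2^n)^2 + 2^n - 1) = b}.ncard
        ≤ (2^n)^2) ∧
    {x : F | x ^ ((2^n)^3 + (2^n)^2 + 2^n - 1) + (x + 1) ^ ((2^n)^3 + (2^n)^2 + 2^n - 1) = 1}.ncard
      = (2^n)^2 := by
  classical
  have h2 : (2 : F) = 0 := by
    have h := FiniteField.cast_card_eq_zero F
    rw [hF] at h
    push_cast at h
    exact eq_zero_of_pow_eq_zero (eq_zero_of_pow_eq_zero h)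
  have : CharP F 2 := CharTwo.of_one_ne_zero_of_two_eq_zero one_ne_zero h2
  have hq : 2 ≤ 2 ^ n := by
    calc 2 = 2 ^ 1 := rfl
      _ ≤ 2 ^ n := Nat.pow_le_pow_right (by norm_num) hn
  let σ : F →+* F := iterateFrobenius F 2 n
  have σd : ∀ x, σ x = x ^ (2 ^ n) := fun x => iterateFrobenius_def ..
  clear_value σ
  generalize 2 ^ n = q at *
  have σ2 : ∀ x, σ (σ x) = x ^ (q ^ 2) := fun x => by rw [σd, σd, ← pow_mul]; congr 1; ring
  have hσ : ∀ x, σ (σ (σ (σ x))) = x := fun x => by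
    rw [σ2, σ2, ← pow_mul]
    conv_rhs => rw [← FiniteField.pow_card x, hF]
    congr 1; ring
  obtain ⟨d, hd⟩ : ∃ d, d = q ^ 3 + q ^ 2 + q - 1 := ⟨_, rfl⟩
  rw [← hd]
  have hd2 : d + 2 = q ^ 3 + q ^ 2 + q + 1 := by omega
  have hd0 : d ≠ 0 := by omega
  have hnm : ∀ x, x ^ d * x ^ 2 = nm σ x := fun x => by
    rw [← pow_add, hd2, nm, σ2, σd, σd, ← pow_mul]; ring
  have hinj : Function.Injective (fun x : F => x ^ 2) := fun x y h => sq_inj h2 h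
  have hsurj : ∀ y : F, ∃ x : F, x ^ 2 = y := Finite.surjective_of_injective hinj
  choose r hr using hsurj
  have hFq : (Finset.univ.filter (fun x : F => σ x = x)).card ≤ q := by
    simpa only [σd] using card_fix_le (F := F) q (by omega)
  have hKc : (Finset.univ.filter (fun x : F => σ (σ x) = x)).card = q ^ 2 := by
    apply le_antisymm
    · simpa only [σ2] using card_fix_le (F := F) (q ^ 2) (by nlinarith)
    · exact card_K h2 σ hσ q hF
  have hKd : ∀ x, σ (σ x) = x → x ^ d = (σ x) ^ 2 := by
    intro x hx
    by_cases h0 : x = 0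
    · simp [h0, hd0]
    · apply mul_right_cancel₀ (pow_ne_zero 2 h0)
      rw [hnm, nm, hx]; ring
  have hK1 : ∀ x, σ (σ x) = x → x ^ d + (x + 1) ^ d = 1 := by
    intro x hx
    rw [hKd x hx, hKd (x + 1) (by simp [hx]), map_add, map_one]
    linear_combination ((σ x) ^ 2 + σ x) * h2
  set al : F → F := fun x => r (nm σ x) with hal_def
  set ga : F → F := fun x => r (nm σ (x + 1)) with hga_def
  have hal : ∀ x, al x ^ 2 = nm σ x := fun x => hr _
  have hga : ∀ x, ga x ^ 2 = nm σ (x + 1) := fun x => hr _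
  have hE : ∀ β x, σ (σ x) ≠ x → x ^ d + (x + 1) ^ d = β ^ 2 →
      β * x ^ 2 + (β + (al x + ga x)) * x = al x := by
    intro β x hx h
    have : al x * (x + 1) + ga x * x = β * (x * (x + 1)) := by
      apply sq_inj h2
      have e1 := hnm x
      have e2 := hnm (x + 1)
      rw [← hal] at e1
      rw [← hga] at e2
      rw [mul_pow β, ← h]
      linear_combination - (x + 1) ^ 2 * e1 - x ^ 2 * e2 + (al x * (x + 1) * ga x * x) * h2
    linear_combination - this + (al x * x + ga x * x) * h2
  have alQ : ∀ x, σ (al x) = al x := fun x => sq_inj h2 (by rw [← map_pow, hal, nm_fix σ hσ])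
  have gaQ : ∀ x, σ (ga x) = ga x := fun x => sq_inj h2 (by rw [← map_pow, hga, nm_fix σ hσ])
  have hone : {x : F | x ^ d + (x + 1) ^ d = 1}.ncard = q ^ 2 := by
    rw [← hKc, ← Set.ncard_coe_finset]
    congr 1
    ext x
    simp only [Set.mem_ofPred_eq, Finset.coe_filter, Finset.mem_univ, true_and]
    refine ⟨fun h => ?_, hK1 x⟩
    by_contra hx
    have e := hE 1 x hx (by rw [h]; ring)
    apply hx
    refine quad σ 1 (1 + (al x + ga x)) (- al x) x one_ne_zero ?_ ?_ ?_ ?_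
    · linear_combination e
    · simp
    · simp [alQ, gaQ]
    · simp [alQ]
  refine ⟨fun b => ?_, hone⟩
  by_cases hb : b = 1
  · rw [hb, hone]
  · have hset : {x : F | x ^ d + (x + 1) ^ d = b} =
        ((Finset.univ.filter (fun x : F => x ^ d + (x + 1) ^ d = b) : Finset F) : Set F) := by
      ext x; simp
    rw [hset, Set.ncard_coe_finset]
    have hS : ∀ x ∈ Finset.univ.filter (fun x : F => x ^ d + (x + 1) ^ d = b), σ (σ x) ≠ x := by
      intro x hx h
      exact hb ((Finset.mem_filter.mp hx).2.symm.trans (hK1 x h))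
    refine core h2 σ hσ q hq hFq al ga hal hga (r b) _ hS ?_
    intro x hx
    exact hE (r b) x (hS x hx) (by rw [hr]; exact (Finset.mem_filter.mp hx).2)
end
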